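/- For every n ≥ 1, the number of permutations of {1,…,n} whose longest increasing subsequence has length at most 2 equals the n-th Catalan number C_n = (2n)!/(n!(n+1)!). -/

import Mathlib

open Finset

/-- The rectangular Young diagram with `w` columns and `n` rows. -/
def rectDiagram (w n : ℕ) : YoungDiagram where
  cells := Finset.range n ×ˢ Finset.range w
  isLowerSet := by
    rintro ⟨a1, a2⟩ ⟨b1, b2⟩ hba ha
    simp only [Finset.coe_product, Set.mem_prod, Finset.mem_coe, Finset.mem_range,
      Prod.mk_le_mk] at *
    exact ⟨lt_of_le_of_lt hba.1 ha.1, lt_of_le_of_lt hba.2 ha.2⟩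

/-- The content of a semistandard Young tableau: `content T v` is the number of cells whose
entry equals `v`. -/
def SemistandardYoungTableau.content {lam : YoungDiagram}
    (T : SemistandardYoungTableau lam) (v : ℕ) : ℕ :=
  (lam.cells.filter fun c => T c.1 c.2 = v).card

/-- The Kostka number `K_{λ,μ}`: the number of semistandard Young tableaux of shape `λ`
and content `μ`. -/
noncomputable def kostkaNumber (lam : YoungDiagram) (mu : ℕ → ℕ) : ℕ :=
  Nat.card {T : SemistandardYoungTableau lam // ∀ v, T.content v = mu v}

/-- The weight vector `κ^n_a`: each of `1,…,n` appears `a` times, each of `n+1,…,2n`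
appears once. -/
def kappa (n a : ℕ) : ℕ → ℕ := fun v =>
  if 1 ≤ v ∧ v ≤ n then a else if v ≤ 2 * n then 1 else 0

/-- The skew weight vector `κ^{n,k}_a`: each of `1,…,n−k` appears `a` times, each of
`n−k+1,…,2n+k(a−1)` appears once. -/
def kappaSkew (n : ℕ) (k : ℤ) (a : ℕ) : ℕ → ℕ := fun v =>
  if 1 ≤ (v : ℤ) ∧ (v : ℤ) ≤ (n : ℤ) - k then a
  else if (v : ℤ) ≤ 2 * (n : ℤ) + k * ((a : ℤ) - 1) then 1 else 0

/-- A semistandard Young tableau is standard if it contains each of `1,…,N` exactly once,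
where `N` is the number of cells. -/
def SemistandardYoungTableau.IsStandard {lam : YoungDiagram}
    (T : SemistandardYoungTableau lam) : Prop :=
  ∀ v, T.content v = if 1 ≤ v ∧ v ≤ lam.card then 1 else 0

/-- The number of standard Young tableaux of shape `lam`. -/
noncomputable def numSYT (lam : YoungDiagram) : ℕ :=
  Nat.card {T : SemistandardYoungTableau lam // T.IsStandard}

/-- `σ` has longest increasing subsequence of length at most `w`. -/
def HasLisAtMost {n : ℕ} (σ : Equiv.Perm (Fin n)) (w : ℕ) : Prop :=
  ∀ s : Finset (Fin n), StrictMonoOn (⇑σ) ↑s → s.card ≤ w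

/-- There are `k` pairwise disjoint increasing subsequences of `σ`, each of length `w`,
whose value sets are pairwise disjoint and together are exactly `{1,…,kw}`. -/
def HasDisjointIncreasingCover {m : ℕ} (σ : Equiv.Perm (Fin m)) (k w : ℕ) : Prop :=
  ∃ S : Fin k → Finset (Fin m),
    (∀ i, StrictMonoOn (⇑σ) ↑(S i)) ∧
    (∀ i, (S i).card = w) ∧
    (Pairwise fun i j => Disjoint (S i) (S j)) ∧
    (Pairwise fun i j => Disjoint ((S i).image ⇑σ) ((S j).image ⇑σ)) ∧
    (Finset.univ.biUnion fun i => (S i).image ⇑σ) =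
      Finset.univ.filter fun x : Fin m => (x : ℕ) < k * w

/-- `W ≼ V` : `|W| ≥ |V|` and the `i`-th smallest element of `W` is at most the `i`-th
smallest element of `V`, for each `i < |V|`. -/
def colLE (W V : Finset ℕ) : Prop :=
  V.card ≤ W.card ∧
    ∀ i < V.card, (W.sort (· ≤ ·)).getD i 0 ≤ (V.sort (· ≤ ·)).getD i 0

/-- The superfactorial `s(k) = ∏_{i=1}^k i!`. -/
def superfac (k : ℕ) : ℕ := ∏ i ∈ Finset.range k, Nat.factorial (i + 1)

/-- `σ` avoids the pattern 123 and every bottom of an ascending pair has value `< k`. -/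
def AscBound {n : ℕ} (σ : Equiv.Perm (Fin n)) (k : ℕ) : Prop :=
  (∀ i j l : Fin n, i < j → j < l → σ i < σ j → σ j < σ l → False) ∧
  (∀ i j : Fin n, i < j → σ i < σ j → (σ i : ℕ) < k)

theorem hasLisAtMost_two_iff {n : ℕ} (σ : Equiv.Perm (Fin n)) :
    HasLisAtMost σ 2 ↔ AscBound σ n := by
  constructor
  · intro h
    refine ⟨?_, fun i j _ _ => (σ i).isLt⟩
    intro i j l hij hjl h1 h2
    have hs := h {i, j, l} (by
      intro a ha b hb hab
      simp only [Finset.coe_insert, Finset.coe_singleton, Set.mem_insert_iff,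
        Set.mem_singleton_iff] at ha hb
      rcases ha with rfl | rfl | rfl <;> rcases hb with rfl | rfl | rfl <;>
        first | assumption | exact h1.trans h2 | (exfalso; order))
    rw [Finset.card_eq_three.mpr ⟨i, j, l, hij.ne, (hij.trans hjl).ne, hjl.ne, rfl⟩] at hs
    omega
  · rintro ⟨h, -⟩ s hs
    by_contra hc
    push Not at hc
    let e := s.orderEmbOfCardLe (k := 3) hc
    have he : ∀ i, e i ∈ s := fun i => s.orderEmbOfCardLe_mem hc i
    have h01 : e 0 < e 1 := e.strictMono (by decide)
    have h12 : e 1 < e 2 := e.strictMono (by decide)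
    exact h (e 0) (e 1) (e 2) h01 h12 (hs (he 0) (he 1) h01) (hs (he 1) (he 2) h12)

/-- Insert a new first entry of value `v` into the permutation `τ`. -/
def consPerm {n : ℕ} (v : Fin (n + 1)) (τ : Equiv.Perm (Fin n)) : Equiv.Perm (Fin (n + 1)) :=
  ((finSuccEquiv' 0).trans (Equiv.optionCongr τ)).trans (finSuccEquiv' v).symm

theorem consPerm_zero {n : ℕ} (v : Fin (n + 1)) (τ : Equiv.Perm (Fin n)) :
    consPerm v τ 0 = v := by
  simp [consPerm]

theorem consPerm_succ {n : ℕ} (v : Fin (n + 1)) (τ : Equiv.Perm (Fin n)) (i : Fin n) :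
    consPerm v τ i.succ = v.succAbove (τ i) := by
  have : finSuccEquiv' (0 : Fin (n + 1)) i.succ = some i := by
    simpa using finSuccEquiv'_succAbove (0 : Fin (n + 1)) i
  simp [consPerm, this]

theorem consPerm_bijective (n : ℕ) :
    Function.Bijective (fun p : Fin (n + 1) × Equiv.Perm (Fin n) => consPerm p.1 p.2) := by
  rw [Fintype.bijective_iff_injective_and_card]
  constructor
  · rintro ⟨v, τ⟩ ⟨w, ρ⟩ h
    simp only at h
    have h0 : v = w := by
      have := congrArg (fun σ : Equiv.Perm (Fin (n + 1)) => σ 0) h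
      simpa only [consPerm_zero] using this
    subst h0
    refine Prod.ext rfl (Equiv.ext fun i => ?_)
    have := congrArg (fun σ : Equiv.Perm (Fin (n + 1)) => σ i.succ) h
    simp only [consPerm_succ] at this
    exact Fin.succAbove_right_injective this
  · simp [Fintype.card_perm, Nat.factorial_succ]

theorem ascBound_cons_last {n : ℕ} (τ : Equiv.Perm (Fin n)) (k : ℕ) :
    AscBound (consPerm (Fin.last n) τ) k ↔ AscBound τ k := by
  simp only [AscBound, Fin.forall_fin_succ, consPerm_zero, consPerm_succ, Fin.succAbove_last,
    Fin.succ_lt_succ_iff, Fin.castSucc_lt_castSucc_iff, Fin.val_castSucc]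
  have h : ∀ i : Fin n, ¬ (Fin.last n < i.castSucc) := fun i =>
    not_lt.mpr (Fin.le_last _)
  simp [h]

theorem ascBound_cons_lt {n : ℕ} (v : Fin (n + 1)) (hv : (v : ℕ) < n)
    (τ : Equiv.Perm (Fin n)) (k : ℕ) :
    AscBound (consPerm v τ) k ↔ (v : ℕ) < k ∧ AscBound τ v := by
  have hlt : ∀ x : Fin n, v < v.succAbove x ↔ (v : ℕ) ≤ x := by
    intro x
    rw [Fin.lt_succAbove_iff_le_castSucc, Fin.le_def, Fin.val_castSucc]
  constructor
  · rintro ⟨h1, h2⟩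
    refine ⟨?_, ?_, ?_⟩
    · have := h2 0 (τ.symm ⟨v, hv⟩).succ (Fin.succ_pos _)
      rw [consPerm_zero, consPerm_succ] at this
      exact this (by rw [hlt]; simp)
    · intro i j l hij hjl a b
      apply h1 i.succ j.succ l.succ (by simpa) (by simpa) <;> simpa [consPerm_succ]
    · intro i j hij a
      by_contra hc
      apply h1 0 i.succ j.succ (Fin.succ_pos _) (by simpa)
      · rw [consPerm_zero, consPerm_succ, hlt]; omega
      · simpa [consPerm_succ]
  · rintro ⟨hk, h1, h2⟩
    refine ⟨?_, ?_⟩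
    · intro i j l hij hjl a b
      cases j using Fin.cases with
      | zero => exact absurd hij (by simp)
      | succ j =>
      cases l using Fin.cases with
      | zero => exact absurd hjl (by simp)
      | succ l =>
      simp only [consPerm_succ, Fin.succ_lt_succ_iff, Fin.succAbove_lt_succAbove_iff] at a b hjl
      cases i using Fin.cases with
      | zero =>
        rw [consPerm_zero, hlt] at a
        have := h2 j l hjl b
        omega
      | succ i =>
        simp only [consPerm_succ, Fin.succ_lt_succ_iff, Fin.succAbove_lt_succAbove_iff] at a hij
        exact h1 i j l hij hjl a b
    · intro i j hij a
      cases j using Fin.cases with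
      | zero => exact absurd hij (by simp)
      | succ j =>
      cases i using Fin.cases with
      | zero => rwa [consPerm_zero]
      | succ i =>
        simp only [consPerm_succ, Fin.succ_lt_succ_iff, Fin.succAbove_lt_succAbove_iff] at a hij ⊢
        have := h2 i j hij a
        rw [Fin.succAbove_of_castSucc_lt _ _ (by rw [Fin.lt_def]; simpa using this)]
        simp only [Fin.val_castSucc]
        omega

/-- The number of permutations satisfying `AscBound`. -/
noncomputable def ascCount (n k : ℕ) : ℕ := Nat.card {σ : Equiv.Perm (Fin n) // AscBound σ k}

theorem ascCount_succ (n k : ℕ) :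
    ascCount (n + 1) k =
      (∑ v ∈ Finset.range n, if v < k then ascCount n v else 0) + ascCount n k := by
  classical
  have h1 : ascCount (n + 1) k =
      ∑ v : Fin (n + 1), Nat.card {τ : Equiv.Perm (Fin n) // AscBound (consPerm v τ) k} := by
    rw [← Nat.card_sigma]
    refine (Nat.card_congr ?_).symm
    refine (Equiv.subtypeProdEquivSigmaSubtype
      (fun (v : Fin (n + 1)) (τ : Equiv.Perm (Fin n)) => AscBound (consPerm v τ) k)).symm.trans ?_
    exact (Equiv.ofBijective _ (consPerm_bijective n)).subtypeEquiv (fun p => Iff.rfl)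
  rw [h1, Fin.sum_univ_castSucc, Finset.sum_range]
  congr 1
  · refine Finset.sum_congr rfl fun v _ => ?_
    have : ∀ τ : Equiv.Perm (Fin n), AscBound (consPerm v.castSucc τ) k ↔
        (v : ℕ) < k ∧ AscBound τ v := fun τ => by
      simpa using ascBound_cons_lt v.castSucc (by simp) τ k
    simp only [this]
    split_ifs with h
    · simp [h, ascCount]
    · simp [h]
  · simp only [ascBound_cons_last, ascCount]

/-- Ballot numbers. -/
def ballotNum (n : ℕ) : ℕ → ℤ
  | 0 => 1
  | k + 1 => (n + k + 1).choose (k + 1) - (n + k + 1).choose k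

theorem ballotNum_succ (n k : ℕ) :
    ballotNum (n + 1) (k + 1) = ballotNum (n + 1) k + ballotNum n (k + 1) := by
  cases k with
  | zero => simp [ballotNum, add_comm]
  | succ k =>
    simp only [ballotNum]
    have e1 : n + 1 + (k + 1) + 1 = (n + k + 2) + 1 := by ring
    have e2 : n + 1 + k + 1 = n + k + 2 := by ring
    have e3 : n + (k + 1) + 1 = n + k + 2 := by ring
    rw [e1, e2, e3, Nat.choose_succ_succ (n + k + 2) (k + 1), Nat.choose_succ_succ (n + k + 2) k]
    push_cast
    ring

theorem ballotNum_diag (n : ℕ) : ballotNum n (n + 1) = 0 := by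
  simp only [ballotNum]
  have : (n + n + 1).choose (n + 1) = (n + n + 1).choose n :=
    Nat.choose_symm_of_eq_add (by ring)
  rw [this, sub_self]

theorem sum_ballotNum (n k : ℕ) :
    ∑ v ∈ Finset.range (k + 1), ballotNum n v = ballotNum (n + 1) k := by
  induction k with
  | zero => simp [ballotNum, add_comm]
  | succ k ih => rw [Finset.sum_range_succ, ih, ballotNum_succ]

theorem ascCount_top (n k : ℕ) (h : n ≤ k) : ascCount n k = ascCount n n := by
  refine Nat.card_congr (Equiv.subtypeEquivRight fun σ => ?_)
  exact ⟨fun a => ⟨a.1, fun i j _ _ => (σ i).isLt⟩,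
    fun a => ⟨a.1, fun i j _ _ => (σ i).isLt.trans_le h⟩⟩

theorem ascCount_eq (n : ℕ) : ∀ k ≤ n, (ascCount n k : ℤ) = ballotNum n k := by
  induction n with
  | zero =>
    intro k hk
    obtain rfl : k = 0 := by omega
    simp [ascCount, AscBound, ballotNum]
  | succ n ih =>
    have key : ∀ k ≤ n, (ascCount (n + 1) k : ℤ) = ballotNum (n + 1) k := by
      intro k hk
      rw [ascCount_succ, ← sum_ballotNum, Finset.sum_range_succ, ← Finset.sum_filter]
      have : (Finset.range n).filter (· < k) = Finset.range k := by
        ext x; simp; omega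
      rw [this]
      push_cast
      rw [ih k hk]
      congr 1
      refine Finset.sum_congr rfl fun v hv => ih v ?_
      have := Finset.mem_range.mp hv
      omega
    intro k hk
    rcases Nat.lt_or_ge n k with h | h
    · obtain rfl : k = n + 1 := by omega
      rw [ballotNum_succ, ballotNum_diag, add_zero, ← key n le_rfl, ascCount_succ, ascCount_succ,
        ascCount_top n (n + 1) (by omega)]
      congr 2
      refine Finset.sum_congr rfl fun v hv => ?_
      have := Finset.mem_range.mp hv
      rw [if_pos (by omega), if_pos this]
    · exact key k h

/-- The number of permutations of `{1,…,n}` whose longest increasing subsequence has length at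
most `2` is the `n`-th Catalan number `(2n)!/(n!(n+1)!)`. -/
theorem card_lisAtMostTwo_eq_catalan (n : ℕ) (hn : 1 ≤ n) :
    Nat.card {σ : Equiv.Perm (Fin n) // HasLisAtMost σ 2} =
      Nat.factorial (2 * n) / (Nat.factorial n * Nat.factorial (n + 1)) := by
  have h : Nat.card {σ : Equiv.Perm (Fin n) // HasLisAtMost σ 2} = ascCount n n :=
    Nat.card_congr (Equiv.subtypeEquivRight fun σ => hasLisAtMost_two_iff σ)
  rw [h]
  symm
  apply Nat.div_eq_of_eq_mul_left (by positivity)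
  have hb := ascCount_eq n n le_rfl
  obtain ⟨m, rfl⟩ : ∃ m, n = m + 1 := ⟨n - 1, by omega⟩
  simp only [ballotNum] at hb
  have e : m + 1 + m + 1 = 2 * (m + 1) := by ring
  rw [e] at hb
  have c1 := Nat.choose_mul_factorial_mul_factorial (n := 2 * (m + 1)) (k := m + 1) (by omega)
  have c2 := Nat.choose_mul_factorial_mul_factorial (n := 2 * (m + 1)) (k := m) (by omega)
  have e1 : 2 * (m + 1) - (m + 1) = m + 1 := by omega
  have e2 : 2 * (m + 1) - m = m + 2 := by omega
  rw [e1] at c1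
  rw [e2] at c2
  zify at c1 c2 ⊢
  rw [hb]
  have f1 : ((m + 1).factorial : ℤ) = (m + 1) * m.factorial := by
    rw [Nat.factorial_succ]; push_cast; ring
  have f2 : ((m + 2).factorial : ℤ) = (m + 2) * (m + 1).factorial := by
    rw [Nat.factorial_succ (m + 1)]; push_cast; ring
  rw [show m + 1 + 1 = m + 2 from rfl]
  rw [f2] at c2 ⊢
  rw [f1] at c1 c2 ⊢
  linear_combination (-(m + 2 : ℤ)) * c1 + (m + 1 : ℤ) * c2
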